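/- Let k and a be integers with 1 ≤ a ≤ k and k ≢ a (mod 2), and let q be a complex number with |q| < 1. Then ∑_{n_1,…,n_{k−1} ≥ 0} q^{N_1² + N_2² + ⋯ + N_{k−1}² + 2N_a + 2N_{a+2} + ⋯ + 2N_{k−1}} (−q; q²)_{n_{k−1}} / ((q²;q²)_{n_1} (q²;q²)_{n_2} ⋯ (q²;q²)_{n_{k−2}} (q⁴;q⁴)_{n_{k−1}}) = (−q; q²)_∞ (q^a, q^{2k+2−a}, q^{2k+2}; q^{2k+2})_∞ / (q²; q²)_∞, where the subscripts a, a+2, …, k−1 increase in steps of 2 and the sum converges absolutely. -/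

import Mathlib

open Finset

/-- Finite q-Pochhammer symbol `(x;q)_n`. -/
noncomputable def qPoch (q x : ℂ) (n : ℕ) : ℂ :=
  ∏ j ∈ Finset.range n, (1 - x * q ^ j)

/-- Infinite q-Pochhammer symbol `(x;q)_∞`. -/
noncomputable def qPochInf (q x : ℂ) : ℂ :=
  ∏' j : ℕ, (1 - x * q ^ j)

/-- `Nsum m n i = n_i + n_{i+1} + ⋯ + n_m` (1-based), where `n : Fin m → ℕ` lists
`n_1, …, n_m`; in particular `Nsum m n i = 0` for `i > m`. -/
def Nsum (m : ℕ) (n : Fin m → ℕ) (i : ℕ) : ℕ :=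
  ∑ j : Fin m, if i ≤ (j : ℕ) + 1 then n j else 0

/-- Summand of the main theorem: exponent
`N_1² + ⋯ + N_{k-1}² + 2N_a + 2N_{a+2} + ⋯ + 2N_{k-1}`, numerator factor
`(-q;q²)_{n_{k-1}}`, denominator `(q²;q²)_{n_1} ⋯ (q²;q²)_{n_{k-2}} (q⁴;q⁴)_{n_{k-1}}`
(note `n_i = N_i - N_{i+1}` and `N_k = 0`). -/
noncomputable def mainTerm (k a : ℕ) (q : ℂ) (n : Fin (k - 1) → ℕ) : ℂ :=
  q ^ ((∑ i ∈ Finset.Icc 1 (k - 1), (Nsum (k - 1) n i) ^ 2) +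
        ∑ i ∈ (Finset.Icc a (k - 1)).filter (fun i => i % 2 = a % 2),
          2 * Nsum (k - 1) n i) *
    qPoch (q ^ 2) (-q) (Nsum (k - 1) n (k - 1) - Nsum (k - 1) n k) /
    ((∏ i ∈ Finset.Icc 1 (k - 2),
        qPoch (q ^ 2) (q ^ 2) (Nsum (k - 1) n i - Nsum (k - 1) n (i + 1))) *
      qPoch (q ^ 4) (q ^ 4) (Nsum (k - 1) n (k - 1) - Nsum (k - 1) n k))


/-- The reciprocal `1 / (Q;Q)_n`, extended by zero to negative `n`. -/
noncomputable def recipPoch (Q : ℂ) (n : ℤ) : ℂ :=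
  if n < 0 then 0 else (qPoch Q Q n.toNat)⁻¹

/-- The Bailey kernel `1 / ((Q;Q)_{N-r} (Q;Q)_{N+r})`. -/
noncomputable def baileyKernel (Q : ℂ) (N : ℕ) (r : ℤ) : ℂ :=
  recipPoch Q (N - r) * recipPoch Q (N + r)

theorem qPoch_zero (Q x : ℂ) : qPoch Q x 0 = 1 := by simp [qPoch]

theorem qPoch_succ (Q x : ℂ) (n : ℕ) :
    qPoch Q x (n + 1) = qPoch Q x n * (1 - x * Q ^ n) := by
  simp [qPoch, Finset.prod_range_succ]

theorem qPoch_succ_left (Q x : ℂ) (n : ℕ) :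
    qPoch Q x (n + 1) = (1 - x) * qPoch Q (x * Q) n := by
  simp only [qPoch, Finset.prod_range_succ', pow_zero, mul_one]
  rw [mul_comm]
  congr 1
  exact Finset.prod_congr rfl fun j _ => by ring

theorem qPoch_add (Q x : ℂ) (m n : ℕ) :
    qPoch Q x (m + n) = qPoch Q x m * qPoch Q (x * Q ^ m) n := by
  simp only [qPoch, Finset.prod_range_add]
  congr 1
  exact Finset.prod_congr rfl fun j _ => by ring

theorem one_sub_ne_zero_of_norm_lt_one {x : ℂ} (hx : ‖x‖ < 1) : 1 - x ≠ 0 := by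
  intro h
  rw [← sub_eq_zero.mp h] at hx
  simp at hx

theorem norm_mul_pow_lt_one {Q x : ℂ} (hQ : ‖Q‖ < 1) (hx : ‖x‖ < 1) (n : ℕ) :
    ‖x * Q ^ n‖ < 1 := by
  rw [norm_mul, norm_pow]
  calc ‖x‖ * ‖Q‖ ^ n ≤ ‖x‖ * 1 := by
        gcongr
        exact pow_le_one₀ (norm_nonneg _) hQ.le
    _ < 1 := by simpa using hx

theorem qPoch_ne_zero {Q x : ℂ} (hQ : ‖Q‖ < 1) (hx : ‖x‖ < 1) (n : ℕ) :
    qPoch Q x n ≠ 0 :=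
  Finset.prod_ne_zero_iff.mpr fun j _ =>
    one_sub_ne_zero_of_norm_lt_one (norm_mul_pow_lt_one hQ hx j)

theorem recipPoch_natCast (Q : ℂ) (n : ℕ) : recipPoch Q n = (qPoch Q Q n)⁻¹ := by
  simp [recipPoch]

theorem recipPoch_of_neg (Q : ℂ) {n : ℤ} (hn : n < 0) : recipPoch Q n = 0 := by
  simp [recipPoch, hn]

theorem one_sub_zpow_mul_recipPoch {Q : ℂ} (hQ : ‖Q‖ < 1) (n : ℤ) :
    (1 - Q ^ n) * recipPoch Q n = recipPoch Q (n - 1) := by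
  rcases lt_trichotomy n 0 with hn | rfl | hn
  · rw [recipPoch_of_neg Q hn, recipPoch_of_neg Q (by lia), mul_zero]
  · rw [recipPoch_of_neg Q (n := 0 - 1) (by lia), zpow_zero, sub_self, zero_mul]
  · obtain ⟨m, rfl⟩ : ∃ m : ℕ, n = ((m + 1 : ℕ) : ℤ) := ⟨(n - 1).toNat, by lia⟩
    have h : 1 - Q * Q ^ m ≠ 0 :=
      one_sub_ne_zero_of_norm_lt_one (norm_mul_pow_lt_one hQ hQ m)
    have h' := qPoch_ne_zero hQ hQ m
    rw [show ((m + 1 : ℕ) : ℤ) - 1 = (m : ℕ) by push_cast; ring, recipPoch_natCast,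
      recipPoch_natCast, qPoch_succ, zpow_natCast, pow_succ']
    field_simp

theorem baileyKernel_neg (Q : ℂ) (N : ℕ) (r : ℤ) :
    baileyKernel Q N (-r) = baileyKernel Q N r := by
  rw [baileyKernel, baileyKernel, mul_comm, sub_neg_eq_add, ← sub_eq_add_neg]

theorem baileyKernel_eq_zero (Q : ℂ) {N : ℕ} {r : ℤ} (h : r ∉ Finset.Icc (-N : ℤ) N) :
    baileyKernel Q N r = 0 := by
  rw [Finset.mem_Icc, not_and_or] at h
  rcases h with h | h
  · rw [baileyKernel, recipPoch_of_neg Q (n := N + r) (by lia), mul_zero]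
  · rw [baileyKernel, recipPoch_of_neg Q (n := N - r) (by lia), zero_mul]

theorem summable_mul_baileyKernel (Q : ℂ) (N : ℕ) (c : ℤ → ℂ) :
    Summable fun r => c r * baileyKernel Q N r :=
  summable_of_ne_finset_zero (s := Finset.Icc (-N : ℤ) N) fun r hr => by
    rw [baileyKernel_eq_zero Q hr, mul_zero]

theorem summable_mul_recipPoch_mul_recipPoch (Q : ℂ) (M N : ℤ) (c : ℤ → ℂ) :
    Summable fun r => c r * (recipPoch Q (M - r) * recipPoch Q (N + r)) :=
  summable_of_ne_finset_zero (s := Finset.Icc (-N : ℤ) M) fun r hr => by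
    rw [Finset.mem_Icc, not_and_or] at hr
    rcases hr with h | h
    · rw [recipPoch_of_neg Q (n := N + r) (by lia), mul_zero, mul_zero]
    · rw [recipPoch_of_neg Q (n := M - r) (by lia), zero_mul, mul_zero]

/-- The `q`-Chu–Vandermonde sum, in base `q ^ 2`. -/
theorem sum_qChuVandermonde {q : ℂ} (hq : ‖q ^ 2‖ < 1) (N : ℕ) :
    ∀ b y : ℂ, ‖b * q * y‖ < 1 →
      ∑ t ∈ range (N + 1), q ^ (t ^ 2) * y ^ t * qPoch (q ^ 2) b t /
          (qPoch (q ^ 2) (-(b * q * y)) t * qPoch (q ^ 2) (q ^ 2) t *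
            qPoch (q ^ 2) (q ^ 2) (N - t)) =
        qPoch (q ^ 2) (-(q * y)) N /
          (qPoch (q ^ 2) (-(b * q * y)) N * qPoch (q ^ 2) (q ^ 2) N) := by
  induction N with
  | zero => intro b y _; simp [qPoch_zero]
  | succ N ih =>
    intro b y hby
    have hc : ‖-(b * q * y)‖ < 1 := by rwa [norm_neg]
    have hc' : ‖-(b * q ^ 2 * q * y)‖ < 1 := by
      have := norm_mul_pow_lt_one hq hc 1
      rwa [show -(b * q * y) * (q ^ 2) ^ 1 = -(b * q ^ 2 * q * y) by ring] at this
    have hQ (n : ℕ) : 1 - q ^ 2 * (q ^ 2) ^ n ≠ 0 :=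
      one_sub_ne_zero_of_norm_lt_one (norm_mul_pow_lt_one hq hq n)
    have hP (n : ℕ) := qPoch_ne_zero hq hq n
    have hC (n : ℕ) := qPoch_ne_zero hq hc n
    have hC' (n : ℕ) := qPoch_ne_zero hq hc' n
    have h1c := one_sub_ne_zero_of_norm_lt_one hc
    have ih1 := ih b y hby
    have ih2 := ih (b * q ^ 2) y (by rwa [norm_neg] at hc')
    refine mul_left_cancel₀ (hQ N) ?_
    have key : (1 - q ^ 2 * (q ^ 2) ^ N) *
        ∑ t ∈ range (N + 1 + 1), q ^ (t ^ 2) * y ^ t * qPoch (q ^ 2) b t /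
          (qPoch (q ^ 2) (-(b * q * y)) t * qPoch (q ^ 2) (q ^ 2) t *
            qPoch (q ^ 2) (q ^ 2) (N + 1 - t)) =
        ∑ t ∈ range (N + 1), q ^ (t ^ 2) * y ^ t * qPoch (q ^ 2) b t /
          (qPoch (q ^ 2) (-(b * q * y)) t * qPoch (q ^ 2) (q ^ 2) t *
            qPoch (q ^ 2) (q ^ 2) (N - t)) +
        q * y * (q ^ 2) ^ N * (1 - b) / (1 - -(b * q * y)) *
        ∑ t ∈ range (N + 1), q ^ (t ^ 2) * y ^ t * qPoch (q ^ 2) (b * q ^ 2) t /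
          (qPoch (q ^ 2) (-(b * q ^ 2 * q * y)) t * qPoch (q ^ 2) (q ^ 2) t *
            qPoch (q ^ 2) (q ^ 2) (N - t)) := by
      have split : ∀ t ∈ range (N + 1 + 1), (1 - q ^ 2 * (q ^ 2) ^ N) *
          (q ^ (t ^ 2) * y ^ t * qPoch (q ^ 2) b t /
          (qPoch (q ^ 2) (-(b * q * y)) t * qPoch (q ^ 2) (q ^ 2) t *
            qPoch (q ^ 2) (q ^ 2) (N + 1 - t))) =
          (1 - (q ^ 2) ^ (N + 1 - t)) * (q ^ (t ^ 2) * y ^ t * qPoch (q ^ 2) b t /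
          (qPoch (q ^ 2) (-(b * q * y)) t * qPoch (q ^ 2) (q ^ 2) t *
            qPoch (q ^ 2) (q ^ 2) (N + 1 - t))) +
          (q ^ 2) ^ (N + 1 - t) * (1 - (q ^ 2) ^ t) *
          (q ^ (t ^ 2) * y ^ t * qPoch (q ^ 2) b t /
          (qPoch (q ^ 2) (-(b * q * y)) t * qPoch (q ^ 2) (q ^ 2) t *
            qPoch (q ^ 2) (q ^ 2) (N + 1 - t))) := by
        intro t ht
        have h : q ^ 2 * (q ^ 2) ^ N = (q ^ 2) ^ (N + 1 - t) * (q ^ 2) ^ t := by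
          rw [← pow_add, ← pow_succ']
          congr 1
          have := mem_range.mp ht
          lia
        rw [h]
        ring
      rw [mul_sum, sum_congr rfl split, sum_add_distrib]
      congr 1
      · rw [sum_range_succ, Nat.sub_self, pow_zero, sub_self, zero_mul, add_zero]
        refine sum_congr rfl fun t ht => ?_
        have ht' := mem_range.mp ht
        rw [show N + 1 - t = (N - t) + 1 by lia, qPoch_succ, pow_succ']
        have h1 := hQ (N - t)
        have h2 := hP (N - t)
        have h3 := hC t
        have h4 := hP t
        field_simp
      · rw [sum_range_succ', pow_zero (q ^ 2), sub_self, mul_zero, zero_mul, add_zero, mul_sum]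
        refine sum_congr rfl fun t ht => ?_
        have ht' := mem_range.mp ht
        have e : (q ^ 2) ^ N = (q ^ 2) ^ (N - t) * (q ^ 2) ^ t := by
          rw [← pow_add]
          congr 1
          lia
        rw [show N + 1 - (t + 1) = N - t by lia, qPoch_succ_left _ b,
          qPoch_succ_left _ (-(b * q * y)), qPoch_succ _ (q ^ 2), e,
          show -(b * q * y) * q ^ 2 = -(b * q ^ 2 * q * y) by ring]
        have h1 := hQ t
        have h2 := hP (N - t)
        have h3 := hC' t
        have h4 := hP t
        rw [show (q ^ 2) ^ (t + 1) = q ^ 2 * (q ^ 2) ^ t by ring,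
          show q ^ ((t + 1) ^ 2) = q ^ (t ^ 2) * (q ^ 2) ^ t * q by ring]
        generalize (q ^ 2) ^ t = X at *
        generalize qPoch (q ^ 2) (-(b * q ^ 2 * q * y)) t = C at *
        field_simp
        ring
    rw [key, ih1, ih2, qPoch_succ _ (-(q * y)), qPoch_succ _ (q ^ 2)]
    have hrel : (1 - -(b * q * y)) * qPoch (q ^ 2) (-(b * q ^ 2 * q * y)) N =
        qPoch (q ^ 2) (-(b * q * y)) (N + 1) := by
      rw [qPoch_succ_left, show -(b * q * y) * q ^ 2 = -(b * q ^ 2 * q * y) by ring]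
    have hlast : 1 - -(b * q * y) * (q ^ 2) ^ N ≠ 0 :=
      one_sub_ne_zero_of_norm_lt_one (norm_mul_pow_lt_one hq hc N)
    have h2 := hP N
    have h3 := hC N
    have h5 := hQ N
    rw [div_mul_div_comm, ← mul_assoc (1 - -(b * q * y)), hrel, qPoch_succ _ (-(b * q * y))]
    generalize qPoch (q ^ 2) (-(b * q * y)) N = C at *
    generalize (q ^ 2) ^ N = X at *
    generalize hD : 1 - -(b * q * y) * X = D at *
    field_simp
    rw [← hD]
    ring

/-- One step of the Bailey chain acting on the Bailey kernel. -/
theorem sum_recipPoch_mul_baileyKernel {q : ℂ} (hq : ‖q‖ < 1) (n : ℕ) (r : ℤ) :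
    ∑ s ∈ range (n + 1), recipPoch (q ^ 2) (n - s) *
        (q ^ (s ^ 2) * qPoch (q ^ 2) (-q) s * baileyKernel (q ^ 2) s r) =
      q ^ (r.natAbs ^ 2) * qPoch (q ^ 2) (-q) n * baileyKernel (q ^ 2) n r := by
  have hpow (j : ℕ) : ‖q ^ (j + 1)‖ < 1 := by
    rw [norm_pow]
    exact pow_lt_one₀ (norm_nonneg _) hq (by lia)
  have hQ : ‖q ^ 2‖ < 1 := hpow 1
  have main (m : ℕ) : ∑ s ∈ range (n + 1), recipPoch (q ^ 2) (n - s) *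
        (q ^ (s ^ 2) * qPoch (q ^ 2) (-q) s * baileyKernel (q ^ 2) s m) =
      q ^ (m ^ 2) * qPoch (q ^ 2) (-q) n * baileyKernel (q ^ 2) n m := by
    rcases lt_or_ge n m with hnm | hnm
    · rw [baileyKernel_eq_zero (N := n) _ (by rw [mem_Icc]; lia), mul_zero]
      refine sum_eq_zero fun s hs => ?_
      have := mem_range.mp hs
      rw [baileyKernel_eq_zero _ (by rw [mem_Icc]; lia), mul_zero, mul_zero]
    · obtain ⟨N, rfl⟩ := Nat.exists_eq_add_of_le hnm
      have hlow : ∑ s ∈ range m, recipPoch (q ^ 2) ((m + N : ℕ) - s) *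
          (q ^ (s ^ 2) * qPoch (q ^ 2) (-q) s * baileyKernel (q ^ 2) s m) = 0 := by
        refine sum_eq_zero fun s hs => ?_
        have := mem_range.mp hs
        rw [baileyKernel_eq_zero _ (by rw [mem_Icc]; lia), mul_zero, mul_zero]
      have hker (t : ℕ) : baileyKernel (q ^ 2) (m + t) m =
          (qPoch (q ^ 2) (q ^ 2) t * (qPoch (q ^ 2) (q ^ 2) (2 * m) *
            qPoch (q ^ 2) (-(-q ^ (2 * m + 1) * q * q ^ (2 * m))) t))⁻¹ := by
        rw [baileyKernel, show ((m + t : ℕ) : ℤ) - m = (t : ℕ) by push_cast; ring,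
          show ((m + t : ℕ) : ℤ) + m = (2 * m + t : ℕ) by push_cast; ring,
          recipPoch_natCast, recipPoch_natCast, qPoch_add, ← mul_inv,
          show q ^ 2 * (q ^ 2) ^ (2 * m) = -(-q ^ (2 * m + 1) * q * q ^ (2 * m)) by ring]
      have hnum (t : ℕ) : qPoch (q ^ 2) (-q) (m + t) =
          qPoch (q ^ 2) (-q) m * qPoch (q ^ 2) (-q ^ (2 * m + 1)) t := by
        rw [qPoch_add]
        congr 2
        ring
      have cv := sum_qChuVandermonde hQ N (-q ^ (2 * m + 1)) (q ^ (2 * m)) (by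
        have := hpow (4 * m + 1)
        rw [show -q ^ (2 * m + 1) * q * q ^ (2 * m) = -q ^ (4 * m + 1 + 1) by ring, norm_neg]
        exact this)
      rw [show m + N + 1 = m + (N + 1) by ring, sum_range_add, hlow, zero_add, hker, hnum,
        show -q ^ (2 * m + 1) = -(q * q ^ (2 * m)) by ring]
      rw [show -q ^ (2 * m + 1) = -(q * q ^ (2 * m)) by ring] at cv
      have e : q ^ (m ^ 2) * (qPoch (q ^ 2) (-q) m * qPoch (q ^ 2) (-(q * q ^ (2 * m))) N) *
          (qPoch (q ^ 2) (q ^ 2) N * (qPoch (q ^ 2) (q ^ 2) (2 * m) *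
            qPoch (q ^ 2) (-(-(q * q ^ (2 * m)) * q * q ^ (2 * m))) N))⁻¹ =
          q ^ (m ^ 2) * qPoch (q ^ 2) (-q) m * (qPoch (q ^ 2) (q ^ 2) (2 * m))⁻¹ *
          (qPoch (q ^ 2) (-(q * q ^ (2 * m))) N /
          (qPoch (q ^ 2) (-(-(q * q ^ (2 * m)) * q * q ^ (2 * m))) N *
            qPoch (q ^ 2) (q ^ 2) N)) := by
        rw [div_eq_mul_inv, mul_inv, mul_inv, mul_inv]
        ring
      rw [e, ← cv, mul_sum]
      refine sum_congr rfl fun t ht => ?_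
      have := mem_range.mp ht
      rw [hker, hnum, show ((m + N : ℕ) : ℤ) - (m + t : ℕ) = (N - t : ℕ) by lia,
        recipPoch_natCast, show -q ^ (2 * m + 1) = -(q * q ^ (2 * m)) by ring, div_eq_mul_inv,
        mul_inv, mul_inv, mul_inv, mul_inv]
      ring
  rcases Int.natAbs_eq r with h | h
  · have := main r.natAbs
    rwa [← h] at this
  · have := main r.natAbs
    rw [show (r.natAbs : ℤ) = -r by lia] at this
    simpa only [baileyKernel_neg] using this

/-- The summand `(-1)^r q^{A r² - b r}` of a theta series. -/
noncomputable def thetaTerm (q : ℂ) (A b r : ℤ) : ℂ :=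
  (-1) ^ r * q ^ (A * r ^ 2 - b * r)

/-- The Bailey transform `∑_r (-1)^r q^{A r² - b r} / ((q²;q²)_{N-r} (q²;q²)_{N+r})`. -/
noncomputable def baileySum (q : ℂ) (A b : ℤ) (N : ℕ) : ℂ :=
  ∑' r : ℤ, thetaTerm q A b r * baileyKernel (q ^ 2) N r

theorem neg_one_zpow_one_sub (r : ℤ) : (-1 : ℂ) ^ (1 - r) = -(-1) ^ r := by
  rw [zpow_sub₀ (by simp), zpow_one, div_eq_mul_inv, ← inv_zpow]
  norm_num

theorem thetaTerm_mul_zpow {q : ℂ} (hq0 : q ≠ 0) (A b r j : ℤ) :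
    thetaTerm q A b r * q ^ (j * r) = thetaTerm q A (b - j) r := by
  rw [thetaTerm, thetaTerm, mul_assoc, ← zpow_add₀ hq0]
  congr 2
  ring

theorem thetaTerm_mul_pow_sq {q : ℂ} (hq0 : q ≠ 0) (A b r : ℤ) :
    thetaTerm q A b r * q ^ (r.natAbs ^ 2) = thetaTerm q (A + 1) b r := by
  have h : q ^ (r.natAbs ^ 2) = q ^ (r ^ 2) := by
    rw [← Int.natAbs_sq, ← zpow_natCast]
    push_cast
    rfl
  rw [thetaTerm, thetaTerm, mul_assoc, h, ← zpow_add₀ hq0]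
  congr 2
  ring

/-- One step of the Bailey chain raises the quadratic coefficient by one. -/
theorem sum_recipPoch_mul_baileySum {q : ℂ} (hq0 : q ≠ 0) (hq : ‖q‖ < 1) (A b : ℤ) (n : ℕ) :
    ∑ s ∈ range (n + 1), recipPoch (q ^ 2) (n - s) *
        (q ^ (s ^ 2) * (qPoch (q ^ 2) (-q) s * baileySum q A b s)) =
      qPoch (q ^ 2) (-q) n * baileySum q (A + 1) b n := by
  have hs (s : ℕ) : recipPoch (q ^ 2) (n - s) *
        (q ^ (s ^ 2) * (qPoch (q ^ 2) (-q) s * baileySum q A b s)) =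
      ∑' r : ℤ, recipPoch (q ^ 2) (n - s) * (q ^ (s ^ 2) * qPoch (q ^ 2) (-q) s *
        (thetaTerm q A b r * baileyKernel (q ^ 2) s r)) := by
    rw [tsum_mul_left, tsum_mul_left, baileySum]
    ring
  simp_rw [hs]
  rw [← Summable.tsum_finsetSum fun s _ =>
    ((summable_mul_baileyKernel _ _ _).mul_left _).mul_left _, baileySum, ← tsum_mul_left]
  refine tsum_congr fun r => ?_
  rw [← thetaTerm_mul_pow_sq hq0]
  have := congrArg (thetaTerm q A b r * ·) (sum_recipPoch_mul_baileyKernel hq n r)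
  simp only [mul_sum] at this
  refine Eq.trans (sum_congr rfl fun s _ => by ring) (this.trans (by ring))

/-- Multiplication by `q^{2N}` shifts the linear coefficient when the latter is `A - 2`. -/
theorem pow_mul_baileySum {q : ℂ} (hq0 : q ≠ 0) (hq : ‖q‖ < 1) (A : ℤ) (N : ℕ) :
    q ^ (2 * N) * baileySum q A (A - 2) N = baileySum q A A N := by
  have hQ : ‖q ^ 2‖ < 1 := by
    rw [norm_pow]
    exact pow_lt_one₀ (norm_nonneg _) hq (by lia)
  set g : ℤ → ℂ := fun r =>
    thetaTerm q A A r * (recipPoch (q ^ 2) (N - r) * recipPoch (q ^ 2) ((N - 1) + r)) with hg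
  have hanti (r : ℤ) : g (1 - r) = -g r := by
    simp only [hg, thetaTerm, neg_one_zpow_one_sub]
    rw [show A * (1 - r) ^ 2 - A * (1 - r) = A * r ^ 2 - A * r by ring,
      show (N : ℤ) - (1 - r) = N - 1 + r by ring, show (N : ℤ) - 1 + (1 - r) = N - r by ring]
    ring
  have hzero : ∑' r, g r = 0 := by
    have h := (Equiv.subLeft (1 : ℤ)).tsum_eq g
    simp only [Equiv.subLeft_apply, hanti, tsum_neg] at h
    exact self_eq_neg.mp h.symm
  have hterm (r : ℤ) : q ^ (2 * N) * (thetaTerm q A (A - 2) r * baileyKernel (q ^ 2) N r) =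
      thetaTerm q A A r * baileyKernel (q ^ 2) N r - g r := by
    have h := one_sub_zpow_mul_recipPoch hQ (N + r)
    have e : (q ^ 2) ^ ((N : ℤ) + r) = q ^ (2 * N) * q ^ (2 * r) := by
      rw [zpow_add₀ (pow_ne_zero 2 hq0), zpow_natCast, ← pow_mul, ← zpow_natCast q 2,
        ← zpow_mul]
      rfl
    rw [e, show (N : ℤ) + r - 1 = N - 1 + r by ring] at h
    simp only [hg, baileyKernel]
    rw [← thetaTerm_mul_zpow hq0, ← h]
    ring
  rw [baileySum, ← tsum_mul_left, tsum_congr hterm,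
    (summable_mul_baileyKernel _ _ _).tsum_sub (summable_mul_recipPoch_mul_recipPoch _ _ _ _),
    hzero, sub_zero, baileySum]

theorem baileySum_neg (q : ℂ) (A b : ℤ) (N : ℕ) : baileySum q A (-b) N = baileySum q A b N := by
  rw [baileySum, ← (Equiv.neg ℤ).tsum_eq]
  refine tsum_congr fun r => ?_
  simp only [Equiv.neg_apply, baileyKernel_neg, thetaTerm]
  rw [zpow_neg (-1 : ℂ), ← inv_zpow, show A * (-r) ^ 2 - -b * -r = A * r ^ 2 - b * r by ring]
  norm_num

theorem baileySum_two_zero {q : ℂ} (hq0 : q ≠ 0) (hq : ‖q‖ < 1) (N : ℕ) :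
    baileySum q 2 0 N = (qPoch (q ^ 4) (q ^ 4) N)⁻¹ := by
  have hpow (j : ℕ) (hj : j ≠ 0) : ‖q ^ j‖ < 1 := by
    rw [norm_pow]
    exact pow_lt_one₀ (norm_nonneg _) hq hj
  induction N with
  | zero =>
    rw [baileySum, tsum_eq_single 0]
    · simp [thetaTerm, baileyKernel, recipPoch, qPoch_zero]
    · intro r hr
      rw [baileyKernel_eq_zero _ (by rw [mem_Icc]; push_cast; lia), mul_zero]
  | succ N ih =>
    have hD := pow_mul_baileySum hq0 hq 2 (N + 1)
    rw [sub_self] at hD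
    have hD' := baileySum_neg q 2 2 (N + 1)
    have hterm (r : ℤ) : thetaTerm q 2 0 r * baileyKernel (q ^ 2) N r =
        (1 + q ^ (4 * (N + 1))) * (thetaTerm q 2 0 r * baileyKernel (q ^ 2) (N + 1) r) -
        q ^ (2 * (N + 1)) * (thetaTerm q 2 2 r * baileyKernel (q ^ 2) (N + 1) r) -
        q ^ (2 * (N + 1)) * (thetaTerm q 2 (-2) r * baileyKernel (q ^ 2) (N + 1) r) := by
      have h1 := one_sub_zpow_mul_recipPoch (hpow 2 two_ne_zero) ((N + 1 : ℕ) - r)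
      have h2 := one_sub_zpow_mul_recipPoch (hpow 2 two_ne_zero) ((N + 1 : ℕ) + r)
      have e1 : (q ^ 2) ^ (((N + 1 : ℕ) : ℤ) - r) = q ^ (2 * (N + 1)) * q ^ (-2 * r) := by
        rw [sub_eq_add_neg, zpow_add₀ (pow_ne_zero 2 hq0), zpow_natCast, ← pow_mul,
          ← zpow_natCast q 2, ← zpow_mul]
        congr 2
        push_cast
        ring
      have e2 : (q ^ 2) ^ (((N + 1 : ℕ) : ℤ) + r) = q ^ (2 * (N + 1)) * q ^ (2 * r) := by
        rw [zpow_add₀ (pow_ne_zero 2 hq0), zpow_natCast, ← pow_mul, ← zpow_natCast q 2,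
          ← zpow_mul]
        rfl
      rw [e1, show ((N + 1 : ℕ) : ℤ) - r - 1 = N - r by push_cast; ring] at h1
      rw [e2, show ((N + 1 : ℕ) : ℤ) + r - 1 = N + r by push_cast; ring] at h2
      have t1 := thetaTerm_mul_zpow hq0 2 0 r (-2)
      have t2 := thetaTerm_mul_zpow hq0 2 0 r 2
      have hinv : q ^ (-2 * r) * q ^ (2 * r) = 1 := by
        rw [← zpow_add₀ hq0]
        simp
      rw [show (0 : ℤ) - -2 = 2 by ring] at t1
      rw [show (0 : ℤ) - 2 = -2 by ring] at t2
      rw [baileyKernel, ← h1, ← h2, ← t1, ← t2, baileyKernel]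
      linear_combination thetaTerm q 2 0 r * q ^ (4 * (N + 1)) *
        (recipPoch (q ^ 2) ((N + 1 : ℕ) - r) * recipPoch (q ^ 2) ((N + 1 : ℕ) + r)) * hinv
    have hsum (A b : ℤ) := summable_mul_baileyKernel (q ^ 2) (N + 1) (thetaTerm q A b)
    have hrec : baileySum q 2 0 N = (1 + q ^ (4 * (N + 1))) * baileySum q 2 0 (N + 1) -
        q ^ (2 * (N + 1)) * baileySum q 2 2 (N + 1) -
        q ^ (2 * (N + 1)) * baileySum q 2 (-2) (N + 1) := by
      rw [baileySum, tsum_congr hterm, Summable.tsum_sub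
        (((hsum 2 0).mul_left _).sub ((hsum 2 2).mul_left _)) ((hsum 2 (-2)).mul_left _),
        ((hsum 2 0).mul_left _).tsum_sub ((hsum 2 2).mul_left _), tsum_mul_left, tsum_mul_left,
        tsum_mul_left]
      rfl
    rw [hD', ← hD, ih] at hrec
    have hne : 1 - q ^ 4 * (q ^ 4) ^ N ≠ 0 := one_sub_ne_zero_of_norm_lt_one
      (norm_mul_pow_lt_one (hpow 4 (by lia)) (hpow 4 (by lia)) N)
    rw [qPoch_succ, mul_inv, hrec, eq_mul_inv_iff_mul_eq₀ hne]
    ring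

/-- The finite form of the Jacobi triple product. -/
theorem tsum_zpow_mul_baileyKernel {h y : ℂ} (hh0 : h ≠ 0) (hy0 : y ≠ 0) (hh : ‖h ^ 2‖ < 1)
    (n : ℕ) :
    ∑' r : ℤ, (-1) ^ r * h ^ (r ^ 2) * y ^ r * baileyKernel (h ^ 2) n r =
      qPoch (h ^ 2) (h * y) n * qPoch (h ^ 2) (h / y) n * (qPoch (h ^ 2) (h ^ 2) (2 * n))⁻¹ := by
  set c : ℤ → ℂ := fun r => (-1) ^ r * h ^ (r ^ 2) * y ^ r with hc
  have hcsucc (r : ℤ) : c (r + 1) = -(h * y * (h ^ 2) ^ r * c r) := by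
    simp only [hc]
    rw [zpow_add_one₀ (by simp), zpow_add_one₀ hy0, show (r + 1) ^ 2 = r ^ 2 + (2 * r + 1) by ring,
      zpow_add₀ hh0, zpow_add_one₀ hh0, zpow_mul, show h ^ (2 : ℤ) = h ^ 2 from rfl]
    ring
  have hp0 : h ^ 2 ≠ 0 := pow_ne_zero 2 hh0
  induction n with
  | zero =>
    rw [tsum_eq_single 0]
    · simp [baileyKernel, recipPoch, qPoch_zero]
    · intro r hr
      rw [baileyKernel_eq_zero _ (by rw [mem_Icc]; push_cast; lia), mul_zero]
  | succ n ih =>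
    set L : ℤ → ℂ := fun r => recipPoch (h ^ 2) (n + 1 - r) * recipPoch (h ^ 2) (n + r) with hL
    have hLs (d : ℤ → ℂ) : Summable fun r => d r * L r :=
      summable_mul_recipPoch_mul_recipPoch _ _ _ _
    have hKs (d : ℤ → ℂ) := summable_mul_baileyKernel (h ^ 2) n d
    have hK (r : ℤ) : (1 - (h ^ 2) ^ (2 * n + 2)) * baileyKernel (h ^ 2) (n + 1) r =
        L r + (h ^ 2) ^ (n + 1 + r) * L (r + 1) := by
      have h1 := one_sub_zpow_mul_recipPoch hh ((n + 1 : ℕ) - r)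
      have h2 := one_sub_zpow_mul_recipPoch hh ((n + 1 : ℕ) + r)
      have e : (h ^ 2) ^ (2 * n + 2) =
          (h ^ 2) ^ (n + 1 + r) * (h ^ 2) ^ (((n + 1 : ℕ) : ℤ) - r) := by
        rw [← zpow_add₀ hp0, ← zpow_natCast]
        congr 1
        push_cast
        ring
      rw [show ((n + 1 : ℕ) : ℤ) + r - 1 = n + r by push_cast; ring] at h2
      simp only [hL]
      rw [show (n : ℤ) + 1 - (r + 1) = (n + 1 : ℕ) - r - 1 by push_cast; ring,
        ← h1, ← h2, baileyKernel, e]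
      push_cast
      rw [show (n : ℤ) + (r + 1) = n + 1 + r by ring]
      ring
    have hLK (r : ℤ) : (1 - (h ^ 2) ^ (2 * n + 1)) * L r =
        baileyKernel (h ^ 2) n r + (h ^ 2) ^ (n + 1 - r) * baileyKernel (h ^ 2) n (r - 1) := by
      have h1 := one_sub_zpow_mul_recipPoch hh (n + 1 - r)
      have h2 := one_sub_zpow_mul_recipPoch hh (n + r)
      have e : (h ^ 2) ^ (2 * n + 1) = (h ^ 2) ^ (n + 1 - r) * (h ^ 2) ^ ((n : ℤ) + r) := by
        rw [← zpow_add₀ hp0, ← zpow_natCast]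
        congr 1
        push_cast
        ring
      rw [show (n : ℤ) + 1 - r - 1 = n - r by ring] at h1
      rw [baileyKernel, baileyKernel, show (n : ℤ) + (r - 1) = n + r - 1 by ring, ← h1, ← h2,
        show (n : ℤ) - (r - 1) = n + 1 - r by ring, e]
      ring
    have step1 : (1 - (h ^ 2) ^ (2 * n + 2)) * ∑' r, c r * baileyKernel (h ^ 2) (n + 1) r =
        (1 - h / y * (h ^ 2) ^ n) * ∑' r, c r * L r := by
      have hshift : ∑' r, c r * (h ^ 2) ^ (n + 1 + r) * L (r + 1) =
          ∑' r, -(h / y * (h ^ 2) ^ n) * (c r * L r) := by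
        rw [← (Equiv.addRight (1 : ℤ)).tsum_eq fun r => -(h / y * (h ^ 2) ^ n) * (c r * L r)]
        refine tsum_congr fun r => ?_
        simp only [Equiv.coe_addRight]
        rw [hcsucc, zpow_add₀ hp0, zpow_add_one₀ hp0, zpow_natCast]
        field_simp
      have hs2 : Summable fun r => c r * (h ^ 2) ^ (n + 1 + r) * L (r + 1) := by
        refine ((Equiv.addRight (1 : ℤ)).summable_iff.mpr
          (hLs fun r => c (r - 1) * (h ^ 2) ^ (n + r))).congr fun r => ?_
        simp only [Function.comp, Equiv.coe_addRight, add_sub_cancel_right]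
        rw [show (n : ℤ) + (r + 1) = n + 1 + r by ring]
      rw [← tsum_mul_left, sub_mul 1 (_ * _), one_mul, sub_eq_add_neg (∑' _, _), ← neg_mul, ← tsum_mul_left,
        ← hshift,
        ← (hLs c).tsum_add hs2]
      refine tsum_congr fun r => ?_
      rw [mul_left_comm, hK]
      ring
    have step2 : (1 - (h ^ 2) ^ (2 * n + 1)) * ∑' r, c r * L r =
        (1 - h * y * (h ^ 2) ^ n) * ∑' r, c r * baileyKernel (h ^ 2) n r := by
      have hshift : ∑' r, c r * (h ^ 2) ^ (n + 1 - r) * baileyKernel (h ^ 2) n (r - 1) =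
          ∑' r, -(h * y * (h ^ 2) ^ n) * (c r * baileyKernel (h ^ 2) n r) := by
        rw [← (Equiv.addRight (1 : ℤ)).tsum_eq]
        refine tsum_congr fun r => ?_
        simp only [Equiv.coe_addRight, add_sub_cancel_right]
        rw [hcsucc, show (n : ℤ) + 1 - (r + 1) = n - r by ring, zpow_sub₀ hp0, zpow_natCast]
        have := zpow_ne_zero r hp0
        field_simp
      have hs2 : Summable fun r =>
          c r * (h ^ 2) ^ (n + 1 - r) * baileyKernel (h ^ 2) n (r - 1) := by
        refine ((Equiv.subRight (1 : ℤ)).summable_iff.mpr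
          (hKs fun r => c (r + 1) * (h ^ 2) ^ (n - r))).congr fun r => ?_
        simp only [Function.comp, Equiv.subRight_apply, sub_add_cancel]
        rw [show (n : ℤ) - (r - 1) = n + 1 - r by ring]
      rw [← tsum_mul_left, sub_mul 1 (_ * _), one_mul, sub_eq_add_neg (∑' _, _), ← neg_mul, ← tsum_mul_left,
        ← hshift,
        ← (hKs c).tsum_add hs2]
      refine tsum_congr fun r => ?_
      rw [mul_left_comm, hLK]
      ring
    have hne (j : ℕ) : 1 - h ^ 2 * (h ^ 2) ^ j ≠ 0 :=
      one_sub_ne_zero_of_norm_lt_one (norm_mul_pow_lt_one hh hh j)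
    have n1 := hne (2 * n)
    have n2 := hne (2 * n + 1)
    rw [show (h ^ 2) ^ (2 * n + 2) = h ^ 2 * (h ^ 2) ^ (2 * n + 1) by ring] at step1
    rw [show (h ^ 2) ^ (2 * n + 1) = h ^ 2 * (h ^ 2) ^ (2 * n) by ring] at step2
    rw [ih] at step2
    rw [qPoch_succ _ (h * y), qPoch_succ _ (h / y), show 2 * (n + 1) = 2 * n + 1 + 1 by ring,
      qPoch_succ _ (h ^ 2), qPoch_succ _ (h ^ 2), mul_inv, mul_inv]
    refine mul_left_cancel₀ n2 (mul_left_cancel₀ n1 ?_)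
    rw [step1, mul_left_comm, step2]
    generalize 1 - h ^ 2 * (h ^ 2) ^ (2 * n + 1) = X at *
    generalize 1 - h ^ 2 * (h ^ 2) ^ (2 * n) = Y at *
    linear_combination (-(qPoch (h ^ 2) (h * y) n * (1 - h * y * (h ^ 2) ^ n) *
      (qPoch (h ^ 2) (h / y) n * (1 - h / y * (h ^ 2) ^ n)) *
      (qPoch (h ^ 2) (h ^ 2) (2 * n))⁻¹)) * (Y * Y⁻¹ * mul_inv_cancel₀ n2 + mul_inv_cancel₀ n1)

open Filter Topology

theorem summable_norm_neg_mul_pow {Q : ℂ} (hQ : ‖Q‖ < 1) (x : ℂ) :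
    Summable fun j : ℕ => ‖-(x * Q ^ j)‖ := by
  simp only [norm_neg, norm_mul, norm_pow]
  exact (summable_geometric_of_lt_one (norm_nonneg _) hQ).mul_left _

theorem tendsto_qPoch {Q : ℂ} (hQ : ‖Q‖ < 1) (x : ℂ) :
    Tendsto (qPoch Q x) atTop (𝓝 (qPochInf Q x)) := by
  have h := multipliable_one_add_of_summable (summable_norm_neg_mul_pow hQ x)
  simp only [← sub_eq_add_neg] at h
  exact h.hasProd.tendsto_prod_nat

theorem qPochInf_ne_zero {Q x : ℂ} (hQ : ‖Q‖ < 1) (hx : ‖x‖ < 1) : qPochInf Q x ≠ 0 := by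
  have h := tprod_one_add_ne_zero_of_summable (f := fun j : ℕ => -(x * Q ^ j))
    (fun j => by
      rw [← sub_eq_add_neg]
      exact one_sub_ne_zero_of_norm_lt_one (norm_mul_pow_lt_one hQ hx j))
    (summable_norm_neg_mul_pow hQ x)
  simpa only [← sub_eq_add_neg, qPochInf] using h

theorem exists_norm_qPoch_le {Q : ℂ} (hQ : ‖Q‖ < 1) (x : ℂ) :
    ∃ M, 0 ≤ M ∧ ∀ n, ‖qPoch Q x n‖ ≤ M := by
  obtain ⟨M, hM⟩ := (tendsto_qPoch hQ x).norm.bddAbove_range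
  have hM' (n : ℕ) : ‖qPoch Q x n‖ ≤ M := hM ⟨n, rfl⟩
  exact ⟨M, (norm_nonneg _).trans (hM' 0), hM'⟩

theorem exists_norm_inv_qPoch_le {Q x : ℂ} (hQ : ‖Q‖ < 1) (hx : ‖x‖ < 1) :
    ∃ M, 0 ≤ M ∧ ∀ n, ‖(qPoch Q x n)⁻¹‖ ≤ M := by
  obtain ⟨M, hM⟩ := ((tendsto_qPoch hQ x).inv₀ (qPochInf_ne_zero hQ hx)).norm.bddAbove_range
  have hM' (n : ℕ) : ‖(qPoch Q x n)⁻¹‖ ≤ M := hM ⟨n, rfl⟩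
  exact ⟨M, (norm_nonneg _).trans (hM' 0), hM'⟩

theorem exists_norm_recipPoch_le {Q : ℂ} (hQ : ‖Q‖ < 1) :
    ∃ M, 0 ≤ M ∧ ∀ n, ‖recipPoch Q n‖ ≤ M := by
  obtain ⟨M, hM0, hM⟩ := exists_norm_inv_qPoch_le hQ hQ
  refine ⟨M, hM0, fun n => ?_⟩
  rw [recipPoch]
  split_ifs
  · simpa using hM0
  · exact hM _

theorem tendsto_recipPoch_add {Q : ℂ} (hQ : ‖Q‖ < 1) (r : ℤ) :
    Tendsto (fun n : ℕ => recipPoch Q (n + r)) atTop (𝓝 (qPochInf Q Q)⁻¹) := by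
  have hshift : Tendsto (fun n : ℕ => ((n : ℤ) + r).toNat) atTop atTop := by
    refine tendsto_atTop.mpr fun b => ?_
    filter_upwards [eventually_ge_atTop (b + r.natAbs)] with n hn
    lia
  refine (((tendsto_qPoch hQ Q).inv₀ (qPochInf_ne_zero hQ hQ)).comp hshift).congr' ?_
  filter_upwards [eventually_ge_atTop r.natAbs] with n hn
  rw [recipPoch, if_neg (by lia)]
  rfl

/-- Letting `N → ∞` in a sum against the Bailey kernel. -/
theorem tendsto_tsum_mul_baileyKernel {Q : ℂ} (hQ : ‖Q‖ < 1) {c : ℤ → ℂ}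
    (hc : Summable fun r => ‖c r‖) :
    Tendsto (fun N : ℕ => ∑' r, c r * baileyKernel Q N r) atTop
      (𝓝 ((∑' r, c r) * ((qPochInf Q Q)⁻¹ * (qPochInf Q Q)⁻¹))) := by
  obtain ⟨M, hM0, hM⟩ := exists_norm_recipPoch_le hQ
  rw [← tsum_mul_right]
  refine tendsto_tsum_of_dominated_convergence (hc.mul_right (M * M)) (fun r => ?_)
    (Eventually.of_forall fun N r => ?_)
  · exact (((tendsto_recipPoch_add hQ (-r)).congr fun n => by rw [← sub_eq_add_neg]).mul
      (tendsto_recipPoch_add hQ r)).const_mul _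
  · rw [baileyKernel, norm_mul, norm_mul]
    exact mul_le_mul_of_nonneg_left (mul_le_mul (hM _) (hM _) (norm_nonneg _) hM0) (norm_nonneg _)

theorem summable_norm_thetaTerm {q : ℂ} (hq0 : q ≠ 0) (hq : ‖q‖ < 1) {A b : ℤ} (hb : 0 ≤ b)
    (hbA : b < A) : Summable fun r => ‖thetaTerm q A b r‖ := by
  have hgeo : Summable fun r : ℤ => ‖q‖ ^ r.natAbs := by
    refine Summable.of_nat_of_neg ?_ ?_ <;>
    simpa using summable_geometric_of_lt_one (norm_nonneg q) hq
  refine hgeo.of_nonneg_of_le (fun r => norm_nonneg _) fun r => ?_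
  rw [thetaTerm, norm_mul, norm_zpow, norm_neg, norm_one, one_zpow, one_mul, norm_zpow,
    ← zpow_natCast]
  refine zpow_le_zpow_right_of_le_one₀ (norm_pos_iff.mpr hq0) hq.le ?_
  rcases le_or_gt 0 r with hr | hr
  · rw [Int.natAbs_of_nonneg hr]
    nlinarith [mul_nonneg hr (sub_nonneg.mpr (Int.add_one_le_iff.mpr hbA)), Int.le_self_sq r,
      mul_nonneg hb (sub_nonneg.mpr (Int.le_self_sq r))]
  · rw [show (r.natAbs : ℤ) = -r by lia]
    nlinarith [Int.le_self_sq (-r), mul_nonneg hb (neg_nonneg.mpr hr.le), sq_nonneg r,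
      mul_nonneg (sq_nonneg r) (by lia : (0 : ℤ) ≤ A - 1)]

/-- The Jacobi triple product, for the theta series `∑ (-1)^r q^{A r² - b r}`. -/
theorem tsum_thetaTerm {q : ℂ} (hq0 : q ≠ 0) (hq : ‖q‖ < 1) {A b : ℕ} (hbA : b < A) :
    ∑' r, thetaTerm q A b r = qPochInf (q ^ (2 * A)) (q ^ (A - b)) *
      qPochInf (q ^ (2 * A)) (q ^ (A + b)) * qPochInf (q ^ (2 * A)) (q ^ (2 * A)) := by
  have hp : ‖q ^ (2 * A)‖ < 1 := by
    rw [norm_pow]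
    exact pow_lt_one₀ (norm_nonneg _) hq (by lia)
  have hsq : (q ^ A) ^ 2 = q ^ (2 * A) := by rw [← pow_mul, mul_comm]
  have hlim := tendsto_tsum_mul_baileyKernel hp
    (summable_norm_thetaTerm hq0 hq (Int.natCast_nonneg b) (Int.ofNat_lt.mpr hbA))
  have hfin (n : ℕ) : ∑' r, thetaTerm q A b r * baileyKernel (q ^ (2 * A)) n r =
      qPoch (q ^ (2 * A)) (q ^ (A - b)) n * qPoch (q ^ (2 * A)) (q ^ (A + b)) n *
        (qPoch (q ^ (2 * A)) (q ^ (2 * A)) (2 * n))⁻¹ := by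
    have h := tsum_zpow_mul_baileyKernel (h := q ^ A) (y := (q ^ b)⁻¹) (pow_ne_zero _ hq0)
      (inv_ne_zero (pow_ne_zero _ hq0)) (by rwa [hsq]) n
    rw [hsq, div_inv_eq_mul, ← pow_add, ← pow_sub₀ q hq0 hbA.le] at h
    rw [← h]
    refine tsum_congr fun r => ?_
    rw [thetaTerm, sub_eq_add_neg, zpow_add₀ hq0, zpow_mul, ← zpow_natCast q A,
      ← zpow_natCast q b, zpow_neg, zpow_mul q b, inv_zpow, mul_assoc ((-1) ^ r) _ (_⁻¹)]
  simp only [hfin] at hlim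
  have htwo : Tendsto (fun n : ℕ => 2 * n) atTop atTop :=
    tendsto_id.const_mul_atTop' two_pos
  have hne := qPochInf_ne_zero hp hp
  have huniq := tendsto_nhds_unique hlim (((tendsto_qPoch hp _).mul (tendsto_qPoch hp _)).mul
    (((tendsto_qPoch hp _).inv₀ hne).comp htwo))
  rw [← mul_assoc] at huniq
  rw [← mul_right_cancel₀ (inv_ne_zero hne) huniq, inv_mul_cancel_right₀ hne]

/-- The limit `n → ∞` of a convolution with `1 / (Q;Q)_n`. -/
theorem tendsto_qPoch_mul_sum_recipPoch {Q : ℂ} (hQ : ‖Q‖ < 1) {v : ℕ → ℂ}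
    (hv : Summable fun s => ‖v s‖) :
    Tendsto (fun n : ℕ => qPoch Q Q n * ∑ s ∈ range (n + 1), recipPoch Q (n - s) * v s) atTop
      (𝓝 (∑' s, v s)) := by
  obtain ⟨M, hM0, hM⟩ := exists_norm_recipPoch_le hQ
  obtain ⟨M', hM0', hM'⟩ := exists_norm_qPoch_le hQ Q
  have hne := qPochInf_ne_zero hQ hQ
  have hsum (n : ℕ) : qPoch Q Q n * ∑ s ∈ range (n + 1), recipPoch Q (n - s) * v s =
      ∑' s : ℕ, qPoch Q Q n * recipPoch Q (n - s) * v s := by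
    rw [mul_sum, tsum_eq_sum (s := range (n + 1))]
    · exact sum_congr rfl fun s _ => by ring
    · intro s hs
      rw [mem_range] at hs
      rw [recipPoch_of_neg _ (by lia), mul_zero, zero_mul]
  simp only [hsum]
  refine tendsto_tsum_of_dominated_convergence (hv.mul_left (M' * M)) (fun s => ?_)
    (Eventually.of_forall fun n s => ?_)
  · have h := ((tendsto_qPoch hQ Q).mul (tendsto_recipPoch_add hQ (-s))).mul_const (v s)
    rw [mul_inv_cancel₀ hne, one_mul] at h
    simpa only [← sub_eq_add_neg] using h
  · rw [norm_mul, norm_mul]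
    exact mul_le_mul_of_nonneg_right (mul_le_mul (hM' _) (hM _) (norm_nonneg _) hM0')
      (norm_nonneg _)

theorem Nsum_cons_succ (m t : ℕ) (n : Fin m → ℕ) {i : ℕ} (hi : 1 ≤ i) :
    Nsum (m + 1) (Fin.cons t n) (i + 1) = Nsum m n i := by
  rw [Nsum, Nsum, Fin.sum_univ_succ]
  simp only [Fin.val_zero, Fin.cons_zero, Fin.cons_succ, Fin.val_succ, add_le_add_iff_right]
  rw [if_neg (by lia), zero_add]

theorem Nsum_one (m : ℕ) (n : Fin m → ℕ) : Nsum m n 1 = ∑ j, n j := by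
  simp [Nsum]

theorem mainTerm_eq_range (m a : ℕ) (ha : 1 ≤ a) (q : ℂ) (n : Fin (m + 1) → ℕ) :
    mainTerm (m + 2) a q n =
      q ^ (∑ i ∈ range (m + 1), (Nsum (m + 1) n (i + 1) ^ 2 +
          if a ≤ i + 1 ∧ (i + 1) % 2 = a % 2 then 2 * Nsum (m + 1) n (i + 1) else 0)) *
        (∏ i ∈ range m, (qPoch (q ^ 2) (q ^ 2)
          (Nsum (m + 1) n (i + 1) - Nsum (m + 1) n (i + 2)))⁻¹) *
        (qPoch (q ^ 2) (-q) (Nsum (m + 1) n (m + 1) - Nsum (m + 1) n (m + 2)) /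
          qPoch (q ^ 4) (q ^ 4) (Nsum (m + 1) n (m + 1) - Nsum (m + 1) n (m + 2))) := by
  have hfilter : (Icc a (m + 1)).filter (fun i => i % 2 = a % 2) =
      (Icc 1 (m + 1)).filter (fun i => a ≤ i ∧ i % 2 = a % 2) := by
    ext i
    simp only [mem_filter, mem_Icc]
    lia
  have hIcc (l : ℕ) : Icc 1 l = (range l).map (addRightEmbedding 1) := by
    rw [range_eq_Ico, map_add_right_Ico]
    rfl
  change q ^ ((∑ i ∈ Icc 1 (m + 1), Nsum (m + 1) n i ^ 2) +
      ∑ i ∈ (Icc a (m + 1)).filter (fun i => i % 2 = a % 2), 2 * Nsum (m + 1) n i) *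
    qPoch (q ^ 2) (-q) (Nsum (m + 1) n (m + 1) - Nsum (m + 1) n (m + 2)) /
    ((∏ i ∈ Icc 1 m, qPoch (q ^ 2) (q ^ 2) (Nsum (m + 1) n i - Nsum (m + 1) n (i + 1))) *
      qPoch (q ^ 4) (q ^ 4) (Nsum (m + 1) n (m + 1) - Nsum (m + 1) n (m + 2))) = _
  rw [hfilter, sum_filter, ← sum_add_distrib, hIcc, hIcc, sum_map, prod_map, prod_inv_distrib]
  simp only [addRightEmbedding_apply]
  rw [div_eq_mul_inv, div_eq_mul_inv, mul_inv]
  ring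

theorem mainTerm_cons (m a b : ℕ) (ha : 1 ≤ a) (hb : 1 ≤ b)
    (hab : ∀ i, (a ≤ i + 2 ∧ (i + 2) % 2 = a % 2) ↔ (b ≤ i + 1 ∧ (i + 1) % 2 = b % 2))
    (q : ℂ) (t : ℕ) (n : Fin (m + 1) → ℕ) :
    mainTerm (m + 3) a q (Fin.cons t n : Fin (m + 2) → ℕ) =
      q ^ ((t + ∑ j, n j) ^ 2 + if a = 1 then 2 * (t + ∑ j, n j) else 0) *
        (qPoch (q ^ 2) (q ^ 2) t)⁻¹ * mainTerm (m + 2) b q n := by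
  have hone : Nsum (m + 2) (Fin.cons t n) 1 = t + ∑ j, n j := by
    rw [Nsum_one, Fin.sum_univ_succ]
    simp
  have hs (i : ℕ) : Nsum (m + 2) (Fin.cons t n) (i + 2) = Nsum (m + 1) n (i + 1) :=
    Nsum_cons_succ (m + 1) t n (by lia)
  have hif : (a ≤ 1 ∧ 1 % 2 = a % 2) ↔ a = 1 := by lia
  rw [mainTerm_eq_range (m + 1) a ha, mainTerm_eq_range m b hb, sum_range_succ',
    prod_range_succ']
  simp only [add_assoc, Nat.reduceAdd, hab, hone, hs, zero_add, hif]
  rw [Nsum_one, Nat.add_sub_cancel, pow_add]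
  ring

theorem mainTerm_two (q : ℂ) (n : Fin 1 → ℕ) :
    mainTerm 2 1 q n = q ^ (n 0 ^ 2 + 2 * n 0) *
      (qPoch (q ^ 2) (-q) (n 0) / qPoch (q ^ 4) (q ^ 4) (n 0)) := by
  rw [mainTerm_eq_range 0 1 le_rfl]
  simp [Nsum]

theorem summable_norm_mainTerm {q : ℂ} (hq : ‖q‖ < 1) (m : ℕ) :
    ∀ a, 1 ≤ a → Summable fun n : Fin (m + 1) → ℕ => ‖mainTerm (m + 2) a q n‖ := by
  have hpow (j : ℕ) (hj : j ≠ 0) : ‖q ^ j‖ < 1 := by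
    rw [norm_pow]
    exact pow_lt_one₀ (norm_nonneg _) hq hj
  have hgeo := summable_geometric_of_lt_one (norm_nonneg q) hq
  have hqpow {s e : ℕ} (h : s ≤ e) : ‖q ^ e‖ ≤ ‖q‖ ^ s := by
    rw [norm_pow]
    exact pow_le_pow_of_le_one (norm_nonneg _) hq.le h
  induction m with
  | zero =>
    intro a ha
    obtain ⟨M, hM0, hM⟩ := exists_norm_qPoch_le (hpow 2 two_ne_zero) (-q)
    obtain ⟨M', hM0', hM'⟩ := exists_norm_inv_qPoch_le (hpow 4 (by lia)) (hpow 4 (by lia))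
    refine ((Equiv.funUnique (Fin 1) ℕ).symm.summable_iff).mp ?_
    refine (hgeo.mul_right (M * M')).of_nonneg_of_le (fun _ => norm_nonneg _) fun s => ?_
    simp only [Function.comp]
    rw [mainTerm_eq_range 0 a ha, prod_range_zero, mul_one, div_eq_mul_inv, norm_mul, norm_mul]
    refine mul_le_mul (hqpow ?_) (mul_le_mul (hM _) (hM' _) (norm_nonneg _) hM0)
      (by positivity) (by positivity)
    have hs : Nsum (0 + 1) ((Equiv.funUnique (Fin 1) ℕ).symm s) 1 = s := by simp [Nsum]
    rw [sum_range_succ, sum_range_zero, zero_add]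
    change s ≤ Nsum (0 + 1) ((Equiv.funUnique (Fin 1) ℕ).symm s) 1 ^ 2 + _
    rw [hs]
    exact (Nat.le_self_pow two_ne_zero s).trans (Nat.le_add_right _ _)
  | succ m ih =>
    have step (a b : ℕ) (ha : 1 ≤ a) (hb : 1 ≤ b)
        (hab : ∀ i, (a ≤ i + 2 ∧ (i + 2) % 2 = a % 2) ↔ (b ≤ i + 1 ∧ (i + 1) % 2 = b % 2)) :
        Summable fun n : Fin (m + 2) → ℕ => ‖mainTerm (m + 3) a q n‖ := by
      obtain ⟨M, hM0, hM⟩ := exists_norm_inv_qPoch_le (hpow 2 two_ne_zero) (hpow 2 two_ne_zero)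
      refine ((Fin.consEquiv fun _ : Fin (m + 2) => ℕ).summable_iff).mp ?_
      refine ((hgeo.mul_right M).mul_of_nonneg (ih b hb) (fun _ => by positivity)
        fun _ => norm_nonneg _).of_nonneg_of_le (fun _ => norm_nonneg _) fun x => ?_
      change ‖mainTerm (m + 3) a q (Fin.cons x.1 x.2 : Fin (m + 2) → ℕ)‖ ≤
        ‖q‖ ^ x.1 * M * ‖mainTerm (m + 2) b q x.2‖
      rw [mainTerm_cons m a b ha hb hab, norm_mul, norm_mul]
      refine mul_le_mul_of_nonneg_right (mul_le_mul (hqpow ?_) (hM _) (norm_nonneg _)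
        (by positivity)) (norm_nonneg _)
      exact (Nat.le_add_right _ _).trans
        ((Nat.le_self_pow two_ne_zero (x.1 + ∑ j, x.2 j)).trans (Nat.le_add_right _ _))
    intro a ha
    rcases Nat.lt_or_ge 1 a with h | h
    · exact step a (a - 1) ha (by lia) fun i => by lia
    · exact step a 2 ha (by lia) fun i => by lia

theorem sum_antidiagonalTuple_succ {M : Type*} [AddCommMonoid M] (m N : ℕ)
    (f : (Fin (m + 1) → ℕ) → M) :
    ∑ n ∈ Finset.Nat.antidiagonalTuple (m + 1) N, f n =
      ∑ s ∈ range (N + 1), ∑ n ∈ Finset.Nat.antidiagonalTuple m s,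
        f (Fin.cons (N - s) n : Fin (m + 1) → ℕ) := by
  rw [sum_sigma']
  refine sum_bij' (fun n _ => ⟨∑ j, Fin.tail n j, Fin.tail n⟩)
    (fun x _ => (Fin.cons (N - x.1) x.2 : Fin (m + 1) → ℕ)) ?_ ?_ ?_ ?_ ?_
  · intro n hn
    rw [Finset.Nat.mem_antidiagonalTuple, Fin.sum_univ_succ] at hn
    simp only [mem_sigma, mem_range, Finset.Nat.mem_antidiagonalTuple, Fin.tail]
    lia
  · rintro ⟨s, n⟩ hx
    simp only [mem_sigma, mem_range, Finset.Nat.mem_antidiagonalTuple] at hx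
    rw [Finset.Nat.mem_antidiagonalTuple, Fin.sum_univ_succ]
    simp only [Fin.cons_zero, Fin.cons_succ]
    lia
  · intro n hn
    rw [Finset.Nat.mem_antidiagonalTuple, Fin.sum_univ_succ] at hn
    have h : N - ∑ j, Fin.tail n j = n 0 := by
      simp only [Fin.tail]
      lia
    simp only [h, Fin.cons_self_tail]
  · rintro ⟨s, n⟩ hx
    simp only [mem_sigma, mem_range, Finset.Nat.mem_antidiagonalTuple] at hx
    simp only [Fin.tail_cons, hx.2]
  · intro n hn
    rw [Finset.Nat.mem_antidiagonalTuple, Fin.sum_univ_succ] at hn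
    have h : N - ∑ j, Fin.tail n j = n 0 := by
      simp only [Fin.tail]
      lia
    simp only [h, Fin.cons_self_tail]

/-- The part of the multisum with `N_1 = N` fixed, as a Bailey transform. -/
theorem sum_antidiagonalTuple_mainTerm {q : ℂ} (hq0 : q ≠ 0) (hq : ‖q‖ < 1) (m : ℕ) :
    ∀ a, 1 ≤ a → a ≤ m + 2 → (m + 2) % 2 ≠ a % 2 → ∀ N,
      ∑ n ∈ Finset.Nat.antidiagonalTuple (m + 1) N, mainTerm (m + 2) a q n =
        q ^ (N ^ 2) * (qPoch (q ^ 2) (-q) N * baileySum q (m + 2) (m + 3 - a) N) := by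
  induction m with
  | zero =>
    intro a ha ha2 hpar N
    obtain rfl : a = 1 := by lia
    have hD := pow_mul_baileySum hq0 hq 2 N
    rw [sub_self, baileySum_two_zero hq0 hq] at hD
    rw [Finset.Nat.antidiagonalTuple_one, sum_singleton, mainTerm_two]
    norm_num
    rw [← hD]
    ring
  | succ m ih =>
    have step (a b : ℕ) (ha : 1 ≤ a) (hb : 1 ≤ b) (hbm : b ≤ m + 2)
        (hpar : (m + 2) % 2 ≠ b % 2)
        (hab : ∀ i, (a ≤ i + 2 ∧ (i + 2) % 2 = a % 2) ↔ (b ≤ i + 1 ∧ (i + 1) % 2 = b % 2))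
        (N : ℕ) : ∑ n ∈ Finset.Nat.antidiagonalTuple (m + 2) N, mainTerm (m + 3) a q n =
          q ^ (N ^ 2 + if a = 1 then 2 * N else 0) *
            (qPoch (q ^ 2) (-q) N * baileySum q (m + 3) (m + 3 - b) N) := by
      have hchain := sum_recipPoch_mul_baileySum hq0 hq (m + 2) (m + 3 - b) N
      rw [show (m : ℤ) + 2 + 1 = m + 3 by ring] at hchain
      rw [sum_antidiagonalTuple_succ, ← hchain, mul_sum]
      refine sum_congr rfl fun s hs => ?_
      rw [← ih b hb hbm hpar s, mul_sum, mul_sum]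
      refine sum_congr rfl fun n hn => ?_
      rw [mem_range] at hs
      rw [Finset.Nat.mem_antidiagonalTuple] at hn
      rw [mainTerm_cons m a b ha hb hab, hn, Nat.sub_add_cancel (by lia),
        show (N : ℤ) - s = (N - s : ℕ) by lia, recipPoch_natCast]
      ring
    intro a ha ham hpar N
    rcases Nat.lt_or_ge 1 a with h | h
    · rw [step a (a - 1) ha (by lia) (by lia) (by lia) (fun i => by lia), if_neg (by lia), add_zero,
        show ((m : ℤ) + 3 - (a - 1 : ℕ)) = (m + 1 : ℕ) + 3 - a by lia,
        show ((m : ℤ) + 3) = (m + 1 : ℕ) + 2 by lia]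
    · obtain rfl : a = 1 := by lia
      have hD := pow_mul_baileySum hq0 hq (m + 3) N
      rw [step 1 2 le_rfl (by lia) (by lia) (by lia) (fun i => by lia), if_pos rfl,
        show (((m + 1 : ℕ) : ℤ) + 3 - (1 : ℕ)) = m + 3 by push_cast; ring,
        show (((m + 1 : ℕ) : ℤ) + 2) = m + 3 by push_cast; ring, ← hD]
      push_cast
      ring

theorem hasSum_mainTerm_zero (m a : ℕ) (ha : 1 ≤ a) :
    HasSum (fun n : Fin (m + 1) → ℕ => mainTerm (m + 2) a 0 n) 1 := by
  have hzero : mainTerm (m + 2) a 0 (0 : Fin (m + 1) → ℕ) = 1 := by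
    rw [mainTerm_eq_range m a ha]
    simp [Nsum, qPoch_zero]
  rw [← hzero]
  refine hasSum_single 0 fun n hn => ?_
  rw [mainTerm_eq_range m a ha, zero_pow, zero_mul, zero_mul]
  rw [sum_range_succ', zero_add, Nsum_one]
  have : ∑ j, n j ≠ 0 := fun h => hn (funext fun j => by
    simpa using (sum_eq_zero_iff.mp h) j (mem_univ j))
  have : 0 < (∑ j, n j) ^ 2 := by positivity
  lia

/-- Main theorem: an Andrews–Gordon type identity in the case `k ≢ a (mod 2)`. -/
theorem main_identity (k a : ℕ) (ha : 1 ≤ a) (hak : a ≤ k)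
    (hpar : k % 2 ≠ a % 2) (q : ℂ) (hq : ‖q‖ < 1) :
    Summable (mainTerm k a q) ∧
    ∑' n : Fin (k - 1) → ℕ, mainTerm k a q n =
      qPochInf (q ^ 2) (-q) * qPochInf (q ^ (2 * k + 2)) (q ^ a) *
        qPochInf (q ^ (2 * k + 2)) (q ^ (2 * k + 2 - a)) *
        qPochInf (q ^ (2 * k + 2)) (q ^ (2 * k + 2)) / qPochInf (q ^ 2) (q ^ 2) := by
  obtain ⟨m, rfl⟩ : ∃ m, k = m + 2 := ⟨k - 2, by omega⟩
  have hsum : Summable (mainTerm (m + 2) a q) := (summable_norm_mainTerm hq m a ha).of_norm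
  refine ⟨hsum, ?_⟩
  by_cases hq0 : q = 0
  · subst hq0
    refine (hasSum_mainTerm_zero m a ha).tsum_eq.trans ?_
    rw [zero_pow (by lia : a ≠ 0), zero_pow (by lia : 2 * (m + 2) + 2 - a ≠ 0)]
    simp [qPochInf]
  have hQ : ‖q ^ 2‖ < 1 := by
    rw [norm_pow]
    exact pow_lt_one₀ (norm_nonneg _) hq two_ne_zero
  have hne := qPochInf_ne_zero hQ hQ
  set v : ℕ → ℂ := fun N => ∑ n ∈ Finset.Nat.antidiagonalTuple (m + 1) N, mainTerm (m + 2) a q n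
    with hv
  have hfiber : HasSum v (∑' n : Fin (m + 1) → ℕ, mainTerm (m + 2) a q n) := by
    have h := (Finset.Nat.sigmaAntidiagonalTupleEquivTuple (m + 1)).hasSum_iff.mpr hsum.hasSum
    refine h.sigma fun N => ?_
    simp only [hv, ← sum_coe_sort (Finset.Nat.antidiagonalTuple (m + 1) N)]
    exact hasSum_fintype _
  have hlim := tendsto_qPoch_mul_sum_recipPoch hQ hfiber.summable.norm
  simp only [hv, sum_antidiagonalTuple_mainTerm hq0 hq m a ha hak hpar,
    sum_recipPoch_mul_baileySum hq0 hq] at hlim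
  have htheta := tendsto_tsum_mul_baileyKernel hQ
    (summable_norm_thetaTerm hq0 hq (A := m + 2 + 1) (b := m + 3 - a) (by lia) (by lia))
  have huniq := tendsto_nhds_unique hlim
    ((tendsto_qPoch hQ (q ^ 2)).mul ((tendsto_qPoch hQ (-q)).mul htheta))
  have hjacobi := tsum_thetaTerm hq0 hq (A := m + 3) (b := m + 3 - a) (by lia)
  rw [show ((m + 3 : ℕ) : ℤ) = m + 2 + 1 by push_cast; ring,
    show ((m + 3 - a : ℕ) : ℤ) = m + 3 - a by lia,
    show m + 3 - (m + 3 - a) = a by lia,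
    show m + 3 + (m + 3 - a) = 2 * (m + 2) + 2 - a by lia,
    show 2 * (m + 3) = 2 * (m + 2) + 2 by ring] at hjacobi
  rw [hjacobi] at huniq
  have htsum := hfiber.tsum_eq
  simp only [hv, sum_antidiagonalTuple_mainTerm hq0 hq m a ha hak hpar] at htsum
  refine htsum.symm.trans (huniq.trans ?_)
  field_simp
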